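/- arXiv:2105.05775 — 2 statements merged into one kernel-verified Lean document; each statement's English description precedes it below -/
import Mathlib

section
/- For every pair s = (s¹, s²) of vectors in ℂ⁴: (1) for each C ∈ {1,2}, 3 μ_s sᶜ + Σ_{A,B} ε_{AB} (1/2) Σ_{μ,ν} ω^{CA}_{μν} Γ^{μν} sᴮ = 0; (2) the total symmetrization over the indices (A,B,C) of (1/2) Σ_{μ,ν} ω^{AB}_{μν} Γ^{μν} sᶜ vanishes; and consequently (3) (1/2) Σ_{μ,ν} ω^{AB}_{μν} Γ^{μν} sᶜ = − μ_s (sᴬ ε^{BC} + sᴮ ε^{AC}) for all A, B, C ∈ {1,2}. -/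
open Matrix

noncomputable section

/-- The mostly-minus Minkowski metric η = diag(1,−1,−1,−1,−1) (equal to its own inverse). -/
def eta (μ ν : Fin 5) : ℂ := if μ = ν then (if μ = 0 then 1 else -1) else 0

/-- Γ_{μν} := (1/2)(Γ_μ Γ_ν − Γ_ν Γ_μ). -/
def comm2 (Γ : Fin 5 → Matrix (Fin 4) (Fin 4) ℂ) (μ ν : Fin 5) : Matrix (Fin 4) (Fin 4) ℂ :=
  (1/2 : ℂ) • (Γ μ * Γ ν - Γ ν * Γ μ)

/-- s̄₁ s₂ := s₁ᵀ C s₂. -/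
def bil (Cm : Matrix (Fin 4) (Fin 4) ℂ) (s₁ s₂ : Fin 4 → ℂ) : ℂ := s₁ ⬝ᵥ Cm *ᵥ s₂

/-- s̄₁ M s₂ := s₁ᵀ C M s₂. -/
def bilM (Cm M : Matrix (Fin 4) (Fin 4) ℂ) (s₁ s₂ : Fin 4 → ℂ) : ℂ := s₁ ⬝ᵥ Cm *ᵥ M *ᵥ s₂

/-- The 2×2 symplectic form ε with ε_{12} = 1 (indices 0,1 standing for 1,2). -/
def eps2 (A B : Fin 2) : ℂ := if A = 0 ∧ B = 1 then 1 else if A = 1 ∧ B = 0 then -1 else 0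

/-- The scalar bilinear μ_s := ε_{AB} s̄ᴬ sᴮ. -/
def muS (Cm : Matrix (Fin 4) (Fin 4) ℂ) (s : Fin 2 → Fin 4 → ℂ) : ℂ :=
  ∑ A, ∑ B, eps2 A B * bil Cm (s A) (s B)

/-- The Dirac current with lowered index, κ_{s,μ} := ε_{AB} s̄ᴬ Γ_μ sᴮ. -/
def kappaLow (Γ : Fin 5 → Matrix (Fin 4) (Fin 4) ℂ) (Cm : Matrix (Fin 4) (Fin 4) ℂ)
    (s : Fin 2 → Fin 4 → ℂ) (μ : Fin 5) : ℂ :=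
  ∑ A, ∑ B, eps2 A B * bilM Cm (Γ μ) (s A) (s B)

/-- The Dirac current with raised index, κ_s^μ := η^{μμ} κ_{s,μ} = ε_{AB} s̄ᴬ Γ^μ sᴮ. -/
def kappaUp (Γ : Fin 5 → Matrix (Fin 4) (Fin 4) ℂ) (Cm : Matrix (Fin 4) (Fin 4) ℂ)
    (s : Fin 2 → Fin 4 → ℂ) (μ : Fin 5) : ℂ :=
  eta μ μ * kappaLow Γ Cm s μ

/-- The 2-form bilinears ω^{AB}_{μν} := s̄ᴬ Γ_{μν} sᴮ. -/
def omegaS (Γ : Fin 5 → Matrix (Fin 4) (Fin 4) ℂ) (Cm : Matrix (Fin 4) (Fin 4) ℂ)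
    (s : Fin 2 → Fin 4 → ℂ) (A B : Fin 2) (μ ν : Fin 5) : ℂ :=
  bilM Cm (comm2 Γ μ ν) (s A) (s B)

variable {Γ : Fin 5 → Matrix (Fin 4) (Fin 4) ℂ} {Cm : Matrix (Fin 4) (Fin 4) ℂ}

lemma eta_comm (μ ν : Fin 5) : eta μ ν = eta ν μ := by
  unfold eta
  by_cases h : μ = ν
  · subst h; rfl
  · simp [h, Ne.symm h]

lemma eta_self_mul_self (μ : Fin 5) : eta μ μ * eta μ μ = 1 := by
  unfold eta
  by_cases h : μ = 0 <;> simp [h]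

lemma eta_of_ne {μ ν : Fin 5} (h : μ ≠ ν) : eta μ ν = 0 := by simp [eta, h]

/-- The Clifford relations `Γ_μ Γ_ν + Γ_ν Γ_μ = 2 η_{μν}`. -/
def IsClifford (Γ : Fin 5 → Matrix (Fin 4) (Fin 4) ℂ) : Prop :=
  ∀ μ ν, Γ μ * Γ ν + Γ ν * Γ μ = (2 * eta μ ν) • (1 : Matrix (Fin 4) (Fin 4) ℂ)

namespace IsClifford

lemma swap (hC : IsClifford Γ) (μ ν : Fin 5) :
    Γ μ * Γ ν = (2 * eta μ ν) • (1 : Matrix (Fin 4) (Fin 4) ℂ) - Γ ν * Γ μ :=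
  eq_sub_of_add_eq (hC μ ν)

lemma anticomm (hC : IsClifford Γ) {μ ν : Fin 5} (h : μ ≠ ν) : Γ μ * Γ ν = -(Γ ν * Γ μ) := by
  rw [hC.swap, eta_of_ne h]
  simp

lemma sq (hC : IsClifford Γ) (μ : Fin 5) :
    Γ μ * Γ μ = eta μ μ • (1 : Matrix (Fin 4) (Fin 4) ℂ) := by
  have h := hC μ μ
  rw [← two_smul ℂ (Γ μ * Γ μ), mul_smul] at h
  exact smul_right_injective _ (two_ne_zero : (2 : ℂ) ≠ 0) h

lemma comm2_of_ne (hC : IsClifford Γ) {μ ν : Fin 5} (h : μ ≠ ν) :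
    comm2 Γ μ ν = Γ μ * Γ ν := by
  rw [comm2, hC.anticomm h.symm, sub_neg_eq_add, ← two_smul ℂ (Γ μ * Γ ν), smul_smul]
  norm_num

/-- A matrix anticommuting with one of the generators is traceless. -/
lemma trace_eq_zero (hC : IsClifford Γ) {M : Matrix (Fin 4) (Fin 4) ℂ} (σ : Fin 5)
    (h : Γ σ * M = -(M * Γ σ)) : M.trace = 0 := by
  have key : (Γ σ * (M * Γ σ)).trace = -(Γ σ * (M * Γ σ)).trace := by
    conv_lhs => rw [← mul_assoc, h, neg_mul, trace_neg, mul_assoc, hC.sq]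
    rw [trace_mul_comm (Γ σ), mul_assoc, hC.sq]
  rw [trace_mul_comm, mul_assoc, hC.sq, Matrix.mul_smul, mul_one, trace_smul, smul_eq_mul] at key
  have h0 : eta σ σ * M.trace = 0 := by linear_combination key / 2
  have := eta_self_mul_self σ
  linear_combination eta σ σ * h0 - M.trace * this

lemma trace_gamma (hC : IsClifford Γ) (μ : Fin 5) : (Γ μ).trace = 0 := by
  obtain ⟨σ, hσ⟩ := exists_ne μ
  exact hC.trace_eq_zero σ (hC.anticomm hσ)

lemma trace_gamma_mul (hC : IsClifford Γ) (μ ν : Fin 5) :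
    (Γ μ * Γ ν).trace = 4 * eta μ ν := by
  have h := congrArg trace (hC μ ν)
  rw [trace_add, trace_mul_comm (Γ ν), trace_smul, trace_one] at h
  simp only [Fintype.card_fin, smul_eq_mul, Nat.cast_ofNat] at h
  linear_combination h / 2

lemma trace_gamma_mul_mul (hC : IsClifford Γ) (μ ν ρ : Fin 5) :
    (Γ μ * Γ ν * Γ ρ).trace = 0 := by
  obtain ⟨σ, h1, h2, h3⟩ : ∃ σ : Fin 5, σ ≠ μ ∧ σ ≠ ν ∧ σ ≠ ρ := by
    revert μ ν ρ; decide
  refine hC.trace_eq_zero σ ?_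
  rw [← mul_assoc, ← mul_assoc, hC.anticomm h1, neg_mul, mul_assoc (Γ μ), hC.anticomm h2,
    mul_neg, neg_neg, ← mul_assoc, mul_assoc (Γ μ * Γ ν), hC.anticomm h3, mul_neg, ← mul_assoc]

lemma trace_gamma_mul_mul_mul (hC : IsClifford Γ) (μ ν ρ σ : Fin 5) :
    (Γ μ * Γ ν * Γ ρ * Γ σ).trace =
      4 * (eta μ ν * eta ρ σ - eta μ ρ * eta ν σ + eta μ σ * eta ν ρ) := by
  have h : Γ μ * Γ ν * Γ ρ * Γ σ + Γ ν * Γ ρ * Γ σ * Γ μ =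
      (2 * eta μ ν) • (Γ ρ * Γ σ) - (2 * eta μ ρ) • (Γ ν * Γ σ)
        + (2 * eta μ σ) • (Γ ν * Γ ρ) := by
    have e : Γ μ * Γ ν * Γ ρ * Γ σ + Γ ν * Γ ρ * Γ σ * Γ μ =
        (Γ μ * Γ ν + Γ ν * Γ μ) * (Γ ρ * Γ σ) - Γ ν * (Γ μ * Γ ρ + Γ ρ * Γ μ) * Γ σ
          + Γ ν * Γ ρ * (Γ μ * Γ σ + Γ σ * Γ μ) := by noncomm_ring
    rw [e, hC, hC, hC]
    simp
  have h' := congrArg trace h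
  rw [trace_add, trace_mul_comm (Γ ν * Γ ρ * Γ σ), ← mul_assoc, ← mul_assoc, trace_add,
    trace_sub, trace_smul, trace_smul, trace_smul, hC.trace_gamma_mul, hC.trace_gamma_mul,
    hC.trace_gamma_mul] at h'
  simp only [smul_eq_mul] at h'
  linear_combination h' / 2

end IsClifford

/-- Labels of the sixteen elements `1`, `Γ_μ`, `Γ_μ Γ_ν` (`μ < ν`). -/
abbrev CliffordIndex := Unit ⊕ Fin 5 ⊕ {p : Fin 5 × Fin 5 // p.1 < p.2}

/-- The elements `1`, `Γ_μ`, `Γ_μ Γ_ν` (`μ < ν`). -/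
def cliffordBasis (Γ : Fin 5 → Matrix (Fin 4) (Fin 4) ℂ) :
    CliffordIndex → Matrix (Fin 4) (Fin 4) ℂ :=
  Sum.elim (fun _ => 1) (Sum.elim Γ (fun p => Γ p.1.1 * Γ p.1.2))

/-- The sign relating an element of `cliffordBasis` to its inverse. -/
def cliffordSign : CliffordIndex → ℂ :=
  Sum.elim (fun _ => 1)
    (Sum.elim (fun μ => eta μ μ) (fun p => -(eta p.1.1 p.1.1 * eta p.1.2 p.1.2)))

lemma IsClifford.trace_cliffordBasis_mul (hC : IsClifford Γ) (I J : CliffordIndex) :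
    (cliffordBasis Γ I * (cliffordSign J • cliffordBasis Γ J)).trace =
      if I = J then 4 else 0 := by
  have two : ∀ p : {p : Fin 5 × Fin 5 // p.1 < p.2}, eta p.1.1 p.1.2 = 0 :=
    fun p => eta_of_ne p.2.ne
  rw [Matrix.mul_smul, trace_smul, smul_eq_mul]
  rcases I with _ | μ | p <;> rcases J with _ | ν | q <;>
    simp only [cliffordBasis, cliffordSign, Sum.elim_inl, Sum.elim_inr, one_mul, mul_one,
      trace_one, hC.trace_gamma, hC.trace_gamma_mul, hC.trace_gamma_mul_mul, ← mul_assoc,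
      hC.trace_gamma_mul_mul_mul, two, mul_zero, reduceCtorEq, if_false, if_true,
      Sum.inl.injEq, Sum.inr.injEq, Fintype.card_fin, Nat.cast_ofNat]
  · by_cases h : μ = ν
    · subst h
      rw [if_pos rfl]
      linear_combination 4 * eta_self_mul_self μ
    · rw [if_neg h, eta_of_ne h]
      ring
  · by_cases h : p = q
    · subst h
      rw [if_pos rfl, eta_comm p.1.2 p.1.1, two]
      linear_combination 4 * eta p.1.2 p.1.2 * eta p.1.2 p.1.2 * eta_self_mul_self p.1.1
        + 4 * eta_self_mul_self p.1.2
    · rw [if_neg h]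
      obtain ⟨⟨a, b⟩, hab⟩ := p
      obtain ⟨⟨c, d⟩, hcd⟩ := q
      simp only [Subtype.mk.injEq, Prod.mk.injEq, not_and] at h hab hcd ⊢
      have h1 : eta a c * eta b d = 0 := by
        by_cases hac : a = c
        · rw [eta_of_ne (h hac), mul_zero]
        · rw [eta_of_ne hac, zero_mul]
      have h2 : eta a d * eta b c = 0 := by
        by_cases had : a = d
        · rw [eta_of_ne (by omega : b ≠ c), mul_zero]
        · rw [eta_of_ne had, zero_mul]
      rw [h1, h2]
      ring

/-- Completeness of the sixteen Clifford elements in the space of `4 × 4` matrices. -/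
lemma IsClifford.completeness (hC : IsClifford Γ) (i j k l : Fin 4) :
    ∑ I, cliffordSign I * cliffordBasis Γ I j i * cliffordBasis Γ I k l =
      if i = k ∧ j = l then 4 else 0 := by
  let P : Matrix CliffordIndex (Fin 4 × Fin 4) ℂ := of fun I x => cliffordBasis Γ I x.1 x.2
  let Q : Matrix (Fin 4 × Fin 4) CliffordIndex ℂ :=
    of fun x I => (1/4 : ℂ) * (cliffordSign I * cliffordBasis Γ I x.2 x.1)
  have hPQ : P * Q = 1 := by
    ext I J
    have h := hC.trace_cliffordBasis_mul I J
    simp only [trace, diag_apply, mul_apply, Matrix.smul_apply, smul_eq_mul] at h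
    simp only [P, Q, mul_apply, of_apply, Fintype.sum_prod_type, one_apply]
    simp_rw [mul_left_comm _ (1/4 : ℂ), ← Finset.mul_sum]
    rw [h]
    split_ifs <;> norm_num
  have hQP : Q * P = 1 :=
    (mul_eq_one_comm_of_card_eq CliffordIndex (Fin 4 × Fin 4) ℂ (by decide)).mp hPQ
  have h := congrFun (congrFun hQP (i, j)) (k, l)
  simp only [P, Q, mul_apply, of_apply, one_apply, Prod.mk.injEq, mul_assoc,
    ← Finset.mul_sum] at h
  simp only [mul_assoc]
  split_ifs at h ⊢ <;> linear_combination 4 * h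

/-- The Fierz identity. -/
lemma IsClifford.fierz (hC : IsClifford Γ) (t s u : Fin 4 → ℂ) :
    ∑ I, (cliffordSign I * bilM Cm (cliffordBasis Γ I) t s) • (cliffordBasis Γ I *ᵥ u) =
      (4 * bil Cm t u) • s := by
  ext k
  have e : ∀ I, cliffordSign I * bilM Cm (cliffordBasis Γ I) t s * (cliffordBasis Γ I *ᵥ u) k =
      ∑ j, ∑ i, ∑ l, (t ᵥ* Cm) j * s i * u l *
        (cliffordSign I * cliffordBasis Γ I j i * cliffordBasis Γ I k l) := by
    intro I
    rw [bilM, dotProduct_mulVec]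
    simp only [dotProduct, mulVec, Finset.mul_sum, Finset.sum_mul]
    rw [Finset.sum_comm' (t' := Finset.univ) (s' := fun _ => Finset.univ) (by simp)]
    refine Finset.sum_congr rfl fun j _ => ?_
    rw [Finset.sum_comm]
    refine Finset.sum_congr rfl fun i _ => Finset.sum_congr rfl fun l _ => ?_
    ring
  simp only [Finset.sum_apply, Pi.smul_apply, smul_eq_mul, e]
  rw [Finset.sum_comm]
  simp_rw [Finset.sum_comm (s := (Finset.univ : Finset CliffordIndex)), ← Finset.mul_sum,
    hC.completeness]
  rw [bil, dotProduct_mulVec]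
  simp [ite_and, dotProduct, Finset.sum_mul, Finset.mul_sum, Finset.sum_ite_irrel]
  refine Finset.sum_congr rfl fun j _ => ?_
  ring

lemma dotProduct_mulVec_transpose (M : Matrix (Fin 4) (Fin 4) ℂ) (t s : Fin 4 → ℂ) :
    t ⬝ᵥ M *ᵥ s = s ⬝ᵥ Mᵀ *ᵥ t := by
  rw [dotProduct_mulVec, ← mulVec_transpose, dotProduct_comm]

lemma bil_antisymm (hCt : Cmᵀ = -Cm) (t s : Fin 4 → ℂ) : bil Cm t s = -bil Cm s t := by
  rw [bil, dotProduct_mulVec_transpose, hCt, neg_mulVec, dotProduct_neg, bil]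

lemma bilM_gamma_antisymm (hCt : Cmᵀ = -Cm) (hCΓ : ∀ μ, Cm * Γ μ = (Γ μ)ᵀ * Cm) (μ : Fin 5)
    (t s : Fin 4 → ℂ) : bilM Cm (Γ μ) t s = -bilM Cm (Γ μ) s t := by
  rw [bilM, mulVec_mulVec, dotProduct_mulVec_transpose, transpose_mul, hCt, mul_neg, ← hCΓ,
    neg_mulVec, dotProduct_neg, bilM, mulVec_mulVec]

lemma bilM_gamma_mul (hCt : Cmᵀ = -Cm) (hCΓ : ∀ μ, Cm * Γ μ = (Γ μ)ᵀ * Cm) (μ ν : Fin 5)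
    (t s : Fin 4 → ℂ) : bilM Cm (Γ μ * Γ ν) t s = -bilM Cm (Γ ν * Γ μ) s t := by
  rw [bilM, mulVec_mulVec, dotProduct_mulVec_transpose, transpose_mul, transpose_mul, hCt,
    mul_neg, mul_assoc, ← hCΓ, ← mul_assoc, ← hCΓ, neg_mulVec, dotProduct_neg, bilM,
    mulVec_mulVec, mul_assoc]

lemma bilM_neg (M : Matrix (Fin 4) (Fin 4) ℂ) (t s : Fin 4 → ℂ) :
    bilM Cm (-M) t s = -bilM Cm M t s := by
  simp [bilM, neg_mulVec, mulVec_neg]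

lemma comm2_swap (μ ν : Fin 5) : comm2 Γ ν μ = -comm2 Γ μ ν := by
  rw [comm2, comm2, ← smul_neg, neg_sub]

/-- A symmetric function vanishing on the diagonal is summed twice over the pairs `μ < ν`. -/
lemma sum_sum_eq_two_smul_sum_lt {V : Type*} [AddCommGroup V] [Module ℂ V]
    (f : Fin 5 → Fin 5 → V) (hd : ∀ μ, f μ μ = 0) (hs : ∀ μ ν, f ν μ = f μ ν) :
    ∑ μ, ∑ ν, f μ ν =
      (2 : ℂ) • ∑ p : {p : Fin 5 × Fin 5 // p.1 < p.2}, f p.1.1 p.1.2 := by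
  have split : ∀ μ ν, f μ ν = (if μ < ν then f μ ν else 0) + (if ν < μ then f ν μ else 0) := by
    intro μ ν
    rcases lt_trichotomy μ ν with h | h | h
    · simp [h, h.le]
    · subst h; simp [hd]
    · simp [h, h.le, hs]
  have half : ∑ p : {p : Fin 5 × Fin 5 // p.1 < p.2}, f p.1.1 p.1.2 =
      ∑ μ, ∑ ν, if μ < ν then f μ ν else 0 := by
    rw [← Fintype.sum_prod_type' (f := fun μ ν => if μ < ν then f μ ν else 0),
      ← Finset.sum_filter]
    exact (Finset.sum_subtype _ (by simp) (fun p : Fin 5 × Fin 5 => f p.1 p.2)).symm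
  rw [half, two_smul]
  conv_lhs => enter [2, μ, 2, ν]; rw [split]
  simp only [Finset.sum_add_distrib]
  congr 1
  exact Finset.sum_comm

/-- The Clifford action of the symmetric 2-form bilinear of `t` and `s` on `u`. -/
lemma IsClifford.two_form_action (hC : IsClifford Γ) (hCt : Cmᵀ = -Cm)
    (hCΓ : ∀ μ, Cm * Γ μ = (Γ μ)ᵀ * Cm) (t s u : Fin 4 → ℂ) :
    (1/2 : ℂ) • ∑ μ, ∑ ν,
        (bilM Cm (comm2 Γ μ ν) t s * eta μ μ * eta ν ν) • (comm2 Γ μ ν *ᵥ u) =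
      (-2 : ℂ) • (bil Cm t u • s + bil Cm s u • t) := by
  rw [sum_sum_eq_two_smul_sum_lt, smul_smul]
  · have h1 := hC.fierz (Cm := Cm) t s u
    have h2 := hC.fierz (Cm := Cm) s t u
    have h := congrArg₂ (fun x y => x + y) h1 h2
    beta_reduce at h
    rw [← Finset.sum_add_distrib] at h
    simp only [← add_smul, ← mul_add, Fintype.sum_sum_type] at h
    simp only [cliffordBasis, cliffordSign, Sum.elim_inl, Sum.elim_inr] at h
    have hone : bilM Cm 1 t s + bilM Cm 1 s t = 0 := by
      have := bil_antisymm hCt t s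
      simp only [bilM, one_mulVec]
      unfold bil at this
      rw [this, neg_add_cancel]
    have hgam : ∀ μ, bilM Cm (Γ μ) t s + bilM Cm (Γ μ) s t = 0 := fun μ => by
      rw [bilM_gamma_antisymm hCt hCΓ, neg_add_cancel]
    have htwo : ∀ p : {p : Fin 5 × Fin 5 // p.1 < p.2},
        bilM Cm (Γ p.1.1 * Γ p.1.2) s t = bilM Cm (Γ p.1.1 * Γ p.1.2) t s := fun p => by
      rw [bilM_gamma_mul hCt hCΓ, hC.anticomm p.2.ne', bilM_neg, neg_neg]
    simp only [hone, hgam, htwo, mul_zero, zero_smul, Finset.sum_const_zero, zero_add] at h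
    have hsum : ∑ p : {p : Fin 5 × Fin 5 // p.1 < p.2},
        (bilM Cm (comm2 Γ p.1.1 p.1.2) t s * eta p.1.1 p.1.1 * eta p.1.2 p.1.2) •
          (comm2 Γ p.1.1 p.1.2 *ᵥ u) =
        (-1/2 : ℂ) • ((4 * bil Cm t u) • s + (4 * bil Cm s u) • t) := by
      rw [← h, Finset.smul_sum]
      refine Finset.sum_congr rfl fun p _ => ?_
      rw [hC.comm2_of_ne p.2.ne, smul_smul]
      congr 1
      ring
    rw [hsum]
    module
  · intro μ
    simp [comm2]
  · intro μ ν
    rw [comm2_swap, bilM_neg, neg_mulVec, smul_neg, ← neg_smul]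
    congr 1
    ring

lemma bil_eq_muS (hCt : Cmᵀ = -Cm) (s : Fin 2 → Fin 4 → ℂ) (A B : Fin 2) :
    2 * bil Cm (s A) (s B) = muS Cm s * eps2 A B := by
  have h := bil_antisymm hCt
  have h0 := h (s 0) (s 0)
  have h1 := h (s 1) (s 1)
  have h2 := h (s 1) (s 0)
  fin_cases A <;> fin_cases B <;> simp [muS, eps2, Fin.sum_univ_two]
  · linear_combination h0 / 2
  · linear_combination h2
  · linear_combination h2
  · linear_combination h1 / 2

/-- Identities for the Clifford action of the 2-form bilinears ω^{AB} on the spinor: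
    (1) 3μ_s sᶜ + ε_{AB} ω^{CA}·sᴮ = 0, (2) ω^{(AB}·s^{C)} = 0, and
    (3) ω^{AB}·sᶜ = −μ_s (sᴬ ε^{BC} + sᴮ ε^{AC}),
    where ω^{AB}·sᶜ := (1/2) Σ_{μν} ω^{AB}_{μν} Γ^{μν} sᶜ. -/
theorem omega_action_identities (Γ : Fin 5 → Matrix (Fin 4) (Fin 4) ℂ)
    (Cm : Matrix (Fin 4) (Fin 4) ℂ)
    (hC : ∀ μ ν, Γ μ * Γ ν + Γ ν * Γ μ = (2 * eta μ ν) • (1 : Matrix (Fin 4) (Fin 4) ℂ))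
    (hvol : Γ 0 * Γ 1 * Γ 2 * Γ 3 * Γ 4 = 1)
    (hCt : Cmᵀ = -Cm)
    (hCΓ : ∀ μ, Cm * Γ μ = (Γ μ)ᵀ * Cm)
    (s : Fin 2 → Fin 4 → ℂ) :
    -- (1)
    (∀ C : Fin 2,
      (3 : ℂ) • (muS Cm s • s C)
        + ∑ A, ∑ B, eps2 A B •
            ((1/2 : ℂ) • ∑ μ, ∑ ν,
              (omegaS Γ Cm s C A μ ν * eta μ μ * eta ν ν) • (comm2 Γ μ ν *ᵥ s B)) = 0) ∧
    -- (2)  total symmetrisation over (A,B,C) of ω^{AB}·sᶜ vanishes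
    (∀ A B C : Fin 2,
      ((1/2 : ℂ) • ∑ μ, ∑ ν,
          (omegaS Γ Cm s A B μ ν * eta μ μ * eta ν ν) • (comm2 Γ μ ν *ᵥ s C))
      + ((1/2 : ℂ) • ∑ μ, ∑ ν,
          (omegaS Γ Cm s A C μ ν * eta μ μ * eta ν ν) • (comm2 Γ μ ν *ᵥ s B))
      + ((1/2 : ℂ) • ∑ μ, ∑ ν,
          (omegaS Γ Cm s B A μ ν * eta μ μ * eta ν ν) • (comm2 Γ μ ν *ᵥ s C))
      + ((1/2 : ℂ) • ∑ μ, ∑ ν,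
          (omegaS Γ Cm s B C μ ν * eta μ μ * eta ν ν) • (comm2 Γ μ ν *ᵥ s A))
      + ((1/2 : ℂ) • ∑ μ, ∑ ν,
          (omegaS Γ Cm s C A μ ν * eta μ μ * eta ν ν) • (comm2 Γ μ ν *ᵥ s B))
      + ((1/2 : ℂ) • ∑ μ, ∑ ν,
          (omegaS Γ Cm s C B μ ν * eta μ μ * eta ν ν) • (comm2 Γ μ ν *ᵥ s A)) = 0) ∧
    -- (3)
    (∀ A B C : Fin 2,
      (1/2 : ℂ) • ∑ μ, ∑ ν,
          (omegaS Γ Cm s A B μ ν * eta μ μ * eta ν ν) • (comm2 Γ μ ν *ᵥ s C)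
        = - muS Cm s • (eps2 B C • s A + eps2 A C • s B)) := by
  have key : ∀ A B C : Fin 2,
      (1/2 : ℂ) • ∑ μ, ∑ ν,
          (omegaS Γ Cm s A B μ ν * eta μ μ * eta ν ν) • (comm2 Γ μ ν *ᵥ s C)
        = - muS Cm s • (eps2 B C • s A + eps2 A C • s B) := by
    intro A B C
    refine (IsClifford.two_form_action hC hCt hCΓ (s A) (s B) (s C)).trans ?_
    rw [smul_add, smul_smul, smul_smul, smul_add, smul_smul, smul_smul, neg_mul, neg_mul,
      neg_mul, neg_mul, bil_eq_muS hCt, bil_eq_muS hCt, add_comm]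
  refine ⟨fun C => ?_, fun A B C => ?_, key⟩
  · simp only [key]
    fin_cases C <;> simp [Fin.sum_univ_two, eps2] <;> module
  · simp only [key]
    fin_cases A <;> fin_cases B <;> fin_cases C <;> simp [eps2]
end
end

section
/- For all antisymmetric A, B : Fin 5 → Fin 5 → ℝ and all μ, ν, ρ ∈ Fin 5: (1/3) Σ_{α,β,γ} (ε_{αβγμν} A_ρ{}^α + ε_{αβγνρ} A_μ{}^α + ε_{αβγρμ} A_ν{}^α) B^{βγ} + (2/3) Σ_{α,β,δ} ε_{μνραβ} A^{αδ} B^β{}_δ = 0. -/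
noncomputable section

/-- The mostly-minus Minkowski metric η = diag(1,−1,−1,−1,−1) (equal to its own inverse). -/
def etaR (μ ν : Fin 5) : ℝ := if μ = ν then (if μ = 0 then 1 else -1) else 0

/-- The Levi-Civita symbol on Fin 5 (ε_{01234} = 1). -/
def epsR (μ ν ρ σ τ : Fin 5) : ℝ :=
  if h : Function.Bijective ![μ, ν, ρ, σ, τ] then
    ((Equiv.Perm.sign (Equiv.ofBijective _ h) : ℤ) : ℝ)
  else 0

/-- The Levi-Civita symbol is the Vandermonde product of its indices, divided by `1! 2! 3! 4!`. -/
lemma epsR_eq_vandermonde (a b c d e : Fin 5) :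
    epsR a b c d e =
      (((b : ℕ) : ℝ) - (a : ℕ)) * (((c : ℕ) : ℝ) - (a : ℕ)) * (((d : ℕ) : ℝ) - (a : ℕ)) *
      (((e : ℕ) : ℝ) - (a : ℕ)) * (((c : ℕ) : ℝ) - (b : ℕ)) * (((d : ℕ) : ℝ) - (b : ℕ)) *
      (((e : ℕ) : ℝ) - (b : ℕ)) * (((d : ℕ) : ℝ) - (c : ℕ)) * (((e : ℕ) : ℝ) - (c : ℕ)) *
      (((e : ℕ) : ℝ) - (d : ℕ)) / 288 := by
  have expand (w : Fin 5 → ℝ) : (Matrix.vandermonde w).det =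
      (w 1 - w 0) * (w 2 - w 0) * (w 3 - w 0) * (w 4 - w 0) * (w 2 - w 1) * (w 3 - w 1) *
      (w 4 - w 1) * (w 3 - w 2) * (w 4 - w 2) * (w 4 - w 3) := by
    have h0 : Finset.Ioi (0 : Fin 5) = {1, 2, 3, 4} := by decide
    have h1 : Finset.Ioi (1 : Fin 5) = {2, 3, 4} := by decide
    have h2 : Finset.Ioi (2 : Fin 5) = {3, 4} := by decide
    have h3 : Finset.Ioi (3 : Fin 5) = {4} := by decide
    have h4 : Finset.Ioi (4 : Fin 5) = ∅ := by decide
    rw [Matrix.det_vandermonde]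
    simp [-mul_eq_mul_right_iff, Fin.prod_univ_five, h0, h1, h2, h3, h4]
    ring
  have key : epsR a b c d e * 288 =
      (Matrix.vandermonde fun i => (((![a, b, c, d, e] i : Fin 5) : ℕ) : ℝ)).det := by
    unfold epsR
    split_ifs with h
    · have hperm := Matrix.det_permute (Equiv.ofBijective _ h)
        (Matrix.vandermonde fun i : Fin 5 => ((i : ℕ) : ℝ))
      rw [expand fun i : Fin 5 => ((i : ℕ) : ℝ)] at hperm
      refine Eq.trans ?_ hperm.symm
      norm_num
    · have hinj : ¬ Function.Injective ![a, b, c, d, e] :=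
        fun hi => h (Finite.injective_iff_bijective.mp hi)
      simp only [Function.Injective, not_forall] at hinj
      obtain ⟨i, j, hij, hne⟩ := hinj
      rw [Matrix.det_zero_of_row_eq hne (by ext k; simp [Matrix.vandermonde, hij]), zero_mul]
  rw [eq_div_iff (by norm_num), key, expand]
  simp

/-- The Schouten identity: antisymmetrizing over six indices in dimension five gives zero. -/
lemma epsR_schouten (g : Fin 5 → ℝ) (a b c d e f : Fin 5) :
    epsR a b c d e * g f = epsR f b c d e * g a + epsR a f c d e * g b + epsR a b f d e * g c
      + epsR a b c f e * g d + epsR a b c d f * g e := by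
  have pigeonhole : a = b ∨ a = c ∨ a = d ∨ a = e ∨ a = f ∨ b = c ∨ b = d ∨ b = e ∨ b = f ∨
      c = d ∨ c = e ∨ c = f ∨ d = e ∨ d = f ∨ e = f := by
    omega
  simp only [epsR_eq_vandermonde]
  rcases pigeonhole with h | h | h | h | h | h | h | h | h | h | h | h | h | h | h <;>
    subst h <;> ring

/-- Tensor identity (A.1):
    (1/3) ε_{αβγ[μν} A_{ρ]}{}^α B^{βγ} + (2/3) ε_{μνραβ} A^{αδ} B^β{}_δ = 0. -/
theorem tensor_id_AB_one (A B : Fin 5 → Fin 5 → ℝ)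
    (hA : ∀ μ ν, A μ ν = - A ν μ) (hB : ∀ μ ν, B μ ν = - B ν μ)
    (μ ν ρ : Fin 5) :
    (1/3 : ℝ) * ∑ α, ∑ β, ∑ γ,
        (epsR α β γ μ ν * (etaR α α * A ρ α)
          + epsR α β γ ν ρ * (etaR α α * A μ α)
          + epsR α β γ ρ μ * (etaR α α * A ν α))
        * (etaR β β * etaR γ γ * B β γ)
    + (2/3 : ℝ) * ∑ α, ∑ β, ∑ δ,
        epsR μ ν ρ α β * (etaR α α * etaR δ δ * A α δ) * (etaR β β * B β δ) = 0 := by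
  have pointwise (α β γ : Fin 5) :
      (epsR α β γ μ ν * (etaR α α * A ρ α)
          + epsR α β γ ν ρ * (etaR α α * A μ α)
          + epsR α β γ ρ μ * (etaR α α * A ν α))
        * (etaR β β * etaR γ γ * B β γ) =
      -(epsR μ ν ρ α γ * (etaR α α * etaR β β * A α β) * (etaR γ γ * B γ β))
      - epsR μ ν ρ α β * (etaR α α * etaR γ γ * A α γ) * (etaR β β * B β γ) := by
    have schouten := epsR_schouten (fun x => A x α) α β γ μ ν ρ
    have hαα : A α α = 0 := by linarith [hA α α]
    have e1 : epsR α β γ ρ ν = -epsR α β γ ν ρ := by simp only [epsR_eq_vandermonde]; ring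
    have e2 : epsR α β γ μ ρ = -epsR α β γ ρ μ := by simp only [epsR_eq_vandermonde]; ring
    have e3 : epsR α ρ γ μ ν = -epsR μ ν ρ α γ := by simp only [epsR_eq_vandermonde]; ring
    have e4 : epsR α β ρ μ ν = epsR μ ν ρ α β := by simp only [epsR_eq_vandermonde]; ring
    simp only [hαα, e1, e2, e3, e4] at schouten
    rw [hA α β, hA α γ, hB γ β]
    linear_combination (etaR α α * etaR β β * etaR γ γ * B β γ) * schouten
  simp only [pointwise, Finset.sum_sub_distrib, Finset.sum_neg_distrib]
  have relabel : ∑ α, ∑ β, ∑ γ,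
        epsR μ ν ρ α γ * (etaR α α * etaR β β * A α β) * (etaR γ γ * B γ β) =
      ∑ α, ∑ β, ∑ δ,
        epsR μ ν ρ α β * (etaR α α * etaR δ δ * A α δ) * (etaR β β * B β δ) :=
    Finset.sum_congr rfl fun _ _ => Finset.sum_comm
  rw [relabel]
  ring
end
end
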